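/- Let V be a simple Euclidean Jordan algebra with trace-normalized inner product, rank r > 1 and Peirce invariant d > 0, and let K be its cone of squares. Let M assign to each x ∈ K a σ-finite Borel measure M(x,·) on K, additively and positively homogeneously in x, with M(x,{0}) = 0 and ∫_K min(‖ξ‖²,1) M(x,dξ) < ∞ for all x ∈ K. If ∫_K ⟨χ(ξ),u⟩ M(x,dξ) < ∞ for all u,x ∈ K with ⟨u,x⟩ = 0, then ∫_K min(‖ξ‖,1) M(x,dξ) < ∞ for all x ∈ K. -/

import Mathlib

open MeasureTheory Filter Set
open scoped RealInnerProductSpace ENNReal Topology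

/-- A Euclidean Jordan algebra structure on a finite-dimensional real inner product
space `V`: a commutative bilinear product with unit satisfying the Jordan identity,
compatible with the inner product. -/
structure EuclideanJordanAlgebra (V : Type*) [NormedAddCommGroup V]
    [InnerProductSpace ℝ V] [FiniteDimensional ℝ V] where
  mul : V →ₗ[ℝ] V →ₗ[ℝ] V
  comm : ∀ x y : V, mul x y = mul y x
  jordan : ∀ x y : V, mul (mul x x) (mul x y) = mul x (mul (mul x x) y)
  e : V
  unit : ∀ x : V, mul e x = x
  compat : ∀ x y z : V, ⟪mul x y, z⟫ = ⟪y, mul x z⟫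

namespace EuclideanJordanAlgebra

variable {V : Type*} [NormedAddCommGroup V] [InnerProductSpace ℝ V]
  [FiniteDimensional ℝ V] (J : EuclideanJordanAlgebra V)

/-- The left multiplication operator `L(x) y = x ∘ y`. -/
def L (x : V) : V →ₗ[ℝ] V := J.mul x

/-- The quadratic representation `P(x) = 2 L(x)² − L(x ∘ x)`. -/
def P (x : V) : V →ₗ[ℝ] V := (2 : ℝ) • (J.L x ∘ₗ J.L x) - J.L (J.mul x x)

/-- The cone of squares `K = {x ∘ x : x ∈ V}`. -/
def cone : Set V := {y | ∃ x : V, y = J.mul x x}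

/-- The Jordan algebra is simple: it is nontrivial and its only ideals are `⊥` and
`⊤`. -/
def IsSimple : Prop :=
  Nontrivial V ∧
    ∀ I : Submodule ℝ V, (∀ x : V, ∀ y ∈ I, J.mul x y ∈ I) → I = ⊥ ∨ I = ⊤

/-- `p` is an idempotent: `p ∘ p = p`. -/
def IsIdempotent (p : V) : Prop := J.mul p p = p

/-- `p` is a primitive idempotent: a nonzero idempotent that is not the sum of two
nonzero orthogonal idempotents. -/
def IsPrimitive (p : V) : Prop :=
  J.IsIdempotent p ∧ p ≠ 0 ∧
    ¬∃ q₁ q₂ : V, J.IsIdempotent q₁ ∧ J.IsIdempotent q₂ ∧ q₁ ≠ 0 ∧ q₂ ≠ 0 ∧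
      J.mul q₁ q₂ = 0 ∧ p = q₁ + q₂

/-- A Jordan frame: a family of pairwise orthogonal primitive idempotents summing to
the unit. -/
def IsJordanFrame {k : ℕ} (p : Fin k → V) : Prop :=
  (∀ i, J.IsPrimitive (p i)) ∧ (∀ i j, i ≠ j → J.mul (p i) (p j) = 0) ∧
    (∑ i, p i) = J.e

/-- The Jordan algebra has rank `r`: there is a Jordan frame of cardinality `r` and
every Jordan frame has cardinality `r`. -/
def HasRank (r : ℕ) : Prop :=
  (∃ p : Fin r → V, J.IsJordanFrame p) ∧
    ∀ (k : ℕ) (p : Fin k → V), J.IsJordanFrame p → k = r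

/-- The off-diagonal Peirce space `V_{ab}` of two idempotents: the common
`1/2`-eigenspace of `L(a)` and `L(b)`. -/
noncomputable def peirceSpace (a b : V) : Submodule ℝ V :=
  LinearMap.ker (J.mul a - (1/2 : ℝ) • LinearMap.id) ⊓
    LinearMap.ker (J.mul b - (1/2 : ℝ) • LinearMap.id)

/-- The Jordan algebra has Peirce invariant `d`: all off-diagonal Peirce spaces of
Jordan frames have dimension `d`. -/
def HasPeirceInvariant (d : ℕ) : Prop :=
  ∀ (k : ℕ) (p : Fin k → V), J.IsJordanFrame p → ∀ i j : Fin k, i ≠ j →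
    Module.finrank ℝ (J.peirceSpace (p i) (p j)) = d

/-- The inner product is the trace form, normalized so that `⟪p, p⟫ = 1` for every
primitive idempotent `p`. -/
def TraceNormalized : Prop := ∀ p : V, J.IsPrimitive p → ⟪p, p⟫ = 1

end EuclideanJordanAlgebra

/-- `χ` is a truncation function: continuous, bounded in norm by `1`, and equal to
the identity on a neighborhood of the origin. -/
def IsTruncation {V : Type*} [NormedAddCommGroup V] (χ : V → V) : Prop :=
  Continuous χ ∧ (∀ ξ : V, ‖χ ξ‖ ≤ 1) ∧ ∀ᶠ ξ in nhds (0 : V), χ ξ = ξ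

namespace EuclideanJordanAlgebra

section Helpers

variable {V : Type*} [NormedAddCommGroup V] [InnerProductSpace ℝ V]
  [FiniteDimensional ℝ V] (J : EuclideanJordanAlgebra V)

lemma mul_e (x : V) : J.mul x J.e = x := by rw [J.comm, J.unit]

/-- Linearized Jordan identity. -/
lemma lin (x y z : V) :
    (2 : ℝ) • J.mul (J.mul x y) (J.mul x z) - (2 : ℝ) • J.mul x (J.mul (J.mul x y) z)
      + J.mul (J.mul x x) (J.mul y z) - J.mul y (J.mul (J.mul x x) z) = 0 := by
  have h1 := J.jordan (x + y) z
  have h2 := J.jordan (x - y) z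
  have h3 := J.jordan y z
  have hc : J.mul y x = J.mul x y := J.comm y x
  simp only [map_add, map_sub, LinearMap.add_apply, LinearMap.sub_apply, hc] at h1 h2
  have key : (2 : ℝ) • ((2 : ℝ) • J.mul (J.mul x y) (J.mul x z)
      - (2 : ℝ) • J.mul x (J.mul (J.mul x y) z)
      + J.mul (J.mul x x) (J.mul y z) - J.mul y (J.mul (J.mul x x) z)) = 0 := by
    linear_combination (norm := module) h1 - h2 - (2:ℝ) • h3
  exact (smul_eq_zero.mp key).resolve_left two_ne_zero

/-- The linearized Jordan identity as a formula for `L(x² z)`. -/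
lemma lin' (x y z : V) :
    J.mul (J.mul (J.mul x x) z) y = (2 : ℝ) • J.mul (J.mul x z) (J.mul x y)
      - (2 : ℝ) • J.mul x (J.mul z (J.mul x y)) + J.mul (J.mul x x) (J.mul z y) := by
  have h := J.lin x y z
  rw [J.comm (J.mul x y) (J.mul x z), J.comm (J.mul x y) z, J.comm y z,
    J.comm y (J.mul (J.mul x x) z)] at h
  linear_combination (norm := module) - h

lemma idem_cube {c : V} (hc : J.IsIdempotent c) (y : V) :
    (2 : ℝ) • J.mul c (J.mul c (J.mul c y)) = (3 : ℝ) • J.mul c (J.mul c y) - J.mul c y := by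
  have h := J.lin' c y c
  unfold IsIdempotent at hc
  simp only [hc] at h
  linear_combination (norm := module) h

lemma idem_inner {c : V} (hc : J.IsIdempotent c) (y : V) :
    ⟪J.mul c y, y⟫ = ‖J.mul c y‖ ^ 2 + 4 * ‖J.mul c (J.mul c y) - J.mul c y‖ ^ 2 := by
  have h1 : ∀ u v : V, ⟪J.mul c u, v⟫ = ⟪u, J.mul c v⟫ := fun u v => J.compat c u v
  have h3 := J.idem_cube hc y
  have h4 := congrArg (fun v => ⟪J.mul c y, v⟫) h3
  have h5 := congrArg (fun v => ⟪y, v⟫) h3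
  simp only [inner_sub_right, inner_smul_right] at h4 h5
  rw [← real_inner_self_eq_norm_sq, ← real_inner_self_eq_norm_sq]
  simp only [inner_sub_left, inner_sub_right, h1] at *
  linarith

lemma idem_inner_nonneg {c : V} (hc : J.IsIdempotent c) (y : V) :
    0 ≤ ⟪J.mul c y, y⟫ := by
  rw [J.idem_inner hc]; positivity

lemma idem_inner_zero {c : V} (hc : J.IsIdempotent c) (y : V) (h : ⟪J.mul c y, y⟫ = 0) :
    J.mul c y = 0 := by
  rw [J.idem_inner hc] at h
  have : ‖J.mul c y‖ ^ 2 = 0 := by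
    nlinarith [sq_nonneg ‖J.mul c y‖, sq_nonneg ‖J.mul c (J.mul c y) - J.mul c y‖]
  simpa using this

/-- Powers. -/
def pw (x : V) (n : ℕ) : V := ((J.mul x) ^ n) J.e

lemma pw_zero (x : V) : J.pw x 0 = J.e := by simp [pw]
lemma pw_succ (x : V) (n : ℕ) : J.pw x (n+1) = J.mul x (J.pw x n) := by
  simp [pw, pow_succ']
lemma pw_one (x : V) : J.pw x 1 = x := by rw [pw_succ, pw_zero, mul_e]

lemma commute_sq (x : V) : Commute (J.mul (J.mul x x)) (J.mul x) := by
  ext y; exact J.jordan x y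

lemma sq_pw (x : V) (n : ℕ) : J.mul (J.mul x x) (J.pw x n) = J.pw x (n+2) := by
  have := (J.commute_sq x).pow_right n
  have h := congrArg (fun f => f J.e) this.eq
  simp only [Module.End.mul_apply] at h
  rw [mul_e] at h
  rw [pw, h, pw, pow_add, Module.End.mul_apply]
  simp [pow_succ, mul_e]

lemma commute_pw (x : V) (n : ℕ) :
    Commute (J.mul (J.pw x n)) (J.mul x) ∧ Commute (J.mul (J.pw x (n+1))) (J.mul x) := by
  induction n with
  | zero =>
    refine ⟨?_, ?_⟩
    · ext y; simp [pw_zero, J.unit]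
    · rw [pw_one]
  | succ n ih =>
    refine ⟨ih.2, ?_⟩
    have : J.mul (J.pw x (n+1+1)) = (2:ℝ) • (J.mul (J.pw x (n+1)) * J.mul x)
        - (2:ℝ) • (J.mul x * (J.mul (J.pw x n) * J.mul x))
        + J.mul (J.mul x x) * J.mul (J.pw x n) := by
      ext y
      rw [show n+1+1 = n+2 from rfl, ← sq_pw, J.lin', pw_succ]
      simp
    rw [this]
    have hs := J.commute_sq x
    have hx : Commute (J.mul x) (J.mul x) := Commute.refl _
    exact (((ih.2.mul_left hx).smul_left 2).sub_left
      ((hx.mul_left (ih.1.mul_left hx)).smul_left 2)).add_left (hs.mul_left ih.1)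

lemma pw_mul (x : V) (m n : ℕ) : J.mul (J.pw x m) (J.pw x n) = J.pw x (m + n) := by
  have := ((J.commute_pw x m).1).pow_right n
  have h := congrArg (fun f => f J.e) this.eq
  simp only [Module.End.mul_apply] at h
  rw [mul_e] at h
  rw [show J.pw x n = ((J.mul x)^n) J.e from rfl, h, pw, ← Module.End.mul_apply, ← pow_add,
    add_comm, pw]

/-- Polynomial calculus. -/
noncomputable def ev (x : V) (p : Polynomial ℝ) : V := Polynomial.aeval (J.mul x) p J.e

lemma ev_add (x : V) (p q : Polynomial ℝ) : J.ev x (p + q) = J.ev x p + J.ev x q := by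
  simp [ev]

lemma ev_mul (x : V) (p q : Polynomial ℝ) : J.ev x (p * q) = J.mul (J.ev x p) (J.ev x q) := by
  induction p using Polynomial.induction_on' with
  | add p₁ p₂ h₁ h₂ => rw [add_mul, ev_add, h₁, h₂, ev_add, map_add, LinearMap.add_apply]
  | monomial m a =>
    induction q using Polynomial.induction_on' with
    | add p₁ p₂ h₁ h₂ => rw [mul_add, ev_add, h₁, h₂, ev_add, map_add]
    | monomial n b =>
      have hm : ∀ (k : ℕ) (t : ℝ), J.ev x (Polynomial.monomial k t) = t • J.pw x k := by
        intro k t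
        simp [ev, pw, Polynomial.aeval_monomial, Module.algebraMap_end_apply]
      rw [Polynomial.monomial_mul_monomial, hm, hm, hm, map_smul, map_smul, LinearMap.smul_apply,
        pw_mul, smul_smul, mul_comm a b]

lemma isSymmetric (x : V) : (J.mul x).IsSymmetric := fun u v => J.compat x u v

lemma finite_eig (x : V) : {t : ℝ | Module.End.HasEigenvalue (J.mul x) t}.Finite :=
  Module.End.finite_hasEigenvalue (J.mul x)

lemma ev_eq (x : V) (p q : Polynomial ℝ)
    (h : ∀ t ∈ (J.finite_eig x).toFinset, p.eval t = q.eval t) : J.ev x p = J.ev x q := by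
  have h0 : Polynomial.aeval (J.mul x) (p - q) = 0 := by
    have htop : (⨆ t, Module.End.eigenspace (J.mul x) t) = ⊤ := by
      have := (J.isSymmetric x).orthogonalComplement_iSup_eigenspaces_eq_bot
      exact (Submodule.orthogonal_eq_bot_iff).mp this
    rw [← LinearMap.ker_eq_top, eq_top_iff, ← htop, iSup_le_iff]
    intro t v hv
    rw [LinearMap.mem_ker]
    by_cases hv0 : v = 0
    · simp [hv0]
    have hev : Module.End.HasEigenvector (J.mul x) t v := ⟨hv, hv0⟩
    rw [Module.End.aeval_apply_of_hasEigenvector hev]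
    have : (p - q).eval t = 0 := by
      rw [Polynomial.eval_sub, sub_eq_zero]
      exact h t (by
        simpa using Module.End.hasEigenvalue_of_hasEigenvector hev)
    rw [this, zero_smul]
  rw [map_sub, sub_eq_zero] at h0
  rw [ev, h0, ev]

/-- Spectral theorem. -/
lemma spectral (x : V) : ∃ (S : Finset ℝ) (c : ℝ → V),
    (∀ t ∈ S, J.IsIdempotent (c t)) ∧
    (∀ s ∈ S, ∀ t ∈ S, s ≠ t → J.mul (c s) (c t) = 0) ∧
    (∑ t ∈ S, c t = J.e) ∧ (∑ t ∈ S, t • c t = x) := by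
  classical
  set S := (J.finite_eig x).toFinset with hS
  have hB : ∀ s ∈ S, ∀ t ∈ S,
      (Lagrange.basis S id s).eval t = if s = t then 1 else 0 := by
    intro s hs t ht
    split_ifs with h
    · subst h
      exact Lagrange.eval_basis_self (Function.injective_id.injOn) hs
    · exact Lagrange.eval_basis_of_ne (v := id) h ht
  have hsum : ∀ f : ℝ → ℝ, ∑ t ∈ S, f t • J.ev x (Lagrange.basis S id t)
      = J.ev x (∑ t ∈ S, Polynomial.C (f t) * Lagrange.basis S id t) := by
    intro f
    simp [ev, map_sum, LinearMap.sum_apply, Module.algebraMap_end_apply]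
  have heval : ∀ f : ℝ → ℝ, ∀ t ∈ S,
      (∑ t ∈ S, Polynomial.C (f t) * Lagrange.basis S id t).eval t = f t := by
    intro f t ht
    rw [Polynomial.eval_finsetSum, Finset.sum_eq_single t]
    · rw [Polynomial.eval_mul, hB t ht t ht]; simp
    · intro b hb hbt
      rw [Polynomial.eval_mul, hB b hb t ht]; simp [hbt]
    · intro h; exact absurd ht h
  refine ⟨S, fun t => J.ev x (Lagrange.basis S id t), ?_, ?_, ?_, ?_⟩
  · intro t ht
    unfold IsIdempotent
    rw [← ev_mul]
    apply J.ev_eq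
    intro s hs
    rw [Polynomial.eval_mul, hB t ht s hs]
    split_ifs <;> simp
  · intro s hs t ht hst
    rw [← ev_mul]
    rw [show (0 : V) = J.ev x 0 by simp [ev]]
    apply J.ev_eq
    intro u hu
    rw [Polynomial.eval_mul, hB t ht u hu, hB s hs u hu]
    split_ifs with h1 h2
    · exact absurd (h1.trans h2.symm) hst
    all_goals simp
  · have := hsum (fun _ => 1)
    simp only [one_smul] at this
    rw [this, show J.e = J.ev x 1 by simp [ev]]
    apply J.ev_eq
    intro t ht
    rw [heval (fun _ => 1) t ht]; simp
  · have := hsum (fun t => t)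
    rw [this]
    trans J.ev x Polynomial.X
    · apply J.ev_eq
      intro t ht
      rw [heval (fun t => t) t ht]; simp
    · simp [ev, mul_e]

/-- Product of two combinations of orthogonal idempotents. -/
lemma sum_mul_sum (S : Finset ℝ) (c : ℝ → V)
    (h1 : ∀ t ∈ S, J.IsIdempotent (c t))
    (h2 : ∀ s ∈ S, ∀ t ∈ S, s ≠ t → J.mul (c s) (c t) = 0) (f g : ℝ → ℝ) :
    J.mul (∑ t ∈ S, f t • c t) (∑ t ∈ S, g t • c t) = ∑ t ∈ S, (f t * g t) • c t := by
  rw [map_sum J.mul, LinearMap.sum_apply]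
  refine Finset.sum_congr rfl fun s hs => ?_
  rw [map_sum, Finset.sum_eq_single s]
  · have h : J.mul (c s) (c s) = c s := h1 s hs
    rw [map_smul, map_smul, LinearMap.smul_apply, h, smul_smul, mul_comm]
  · intro t ht hts
    rw [map_smul, map_smul, LinearMap.smul_apply, h2 s hs t ht hts.symm, smul_zero, smul_zero]
  · intro h; exact absurd hs h

lemma idem_mem {p : V} (hp : J.IsIdempotent p) : p ∈ J.cone := ⟨p, hp.symm⟩

lemma mem_of_sq {x : V} {k : ℝ} (hk : 0 < k) (h : J.mul x x = k • x) : x ∈ J.cone := by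
  refine ⟨(√k)⁻¹ • x, ?_⟩
  rw [map_smul, map_smul, LinearMap.smul_apply, h, smul_smul, smul_smul, ← mul_inv,
    Real.mul_self_sqrt hk.le, inv_mul_cancel₀ hk.ne', one_smul]

lemma inner_cone {x y : V} (hx : x ∈ J.cone) (hy : y ∈ J.cone) : 0 ≤ ⟪x, y⟫ := by
  obtain ⟨a, rfl⟩ := hx
  obtain ⟨b, rfl⟩ := hy
  obtain ⟨S, c, h1, h2, -, h4⟩ := J.spectral b
  have hb : J.mul b b = ∑ t ∈ S, (t * t) • c t := by
    conv_lhs => rw [← h4]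
    exact J.sum_mul_sum S c h1 h2 _ _
  rw [hb, inner_sum]
  refine Finset.sum_nonneg fun t ht => ?_
  rw [inner_smul_right, J.compat, J.comm, real_inner_comm]
  exact mul_nonneg (mul_self_nonneg t) (J.idem_inner_nonneg (h1 t ht) a)

lemma exists_bound {x : V} (hx : x ∈ J.cone) : ∃ C : ℝ, 0 ≤ C ∧ C • J.e - x ∈ J.cone := by
  obtain ⟨b, rfl⟩ := hx
  obtain ⟨S, c, h1, h2, h3, h4⟩ := J.spectral b
  have hb : J.mul b b = ∑ t ∈ S, (t * t) • c t := by
    conv_lhs => rw [← h4]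
    exact J.sum_mul_sum S c h1 h2 _ _
  refine ⟨∑ t ∈ S, t * t, Finset.sum_nonneg fun t _ => mul_self_nonneg t,
    ∑ s ∈ S, √((∑ t ∈ S, t * t) - s * s) • c s, ?_⟩
  rw [J.sum_mul_sum S c h1 h2, hb, ← h3, Finset.smul_sum, ← Finset.sum_sub_distrib]
  refine Finset.sum_congr rfl fun s hs => ?_
  rw [Real.mul_self_sqrt, sub_smul]
  have := Finset.single_le_sum (f := fun t : ℝ => t * t) (fun t _ => mul_self_nonneg t) hs
  simpa using this

/-- For a primitive idempotent `p`, the Peirce space `V_1(p)` is `ℝ p`. -/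
lemma prim_line {p : V} (hp : J.IsPrimitive p) {x : V} (hx : J.mul p x = x) :
    ∃ t : ℝ, x = t • p := by
  obtain ⟨hpi, hp0, hpp⟩ := hp
  obtain ⟨S, c, h1, h2, h3, h4⟩ := J.spectral x
  have hb : J.mul x x = ∑ t ∈ S, (t * t) • c t := by
    conv_lhs => rw [← h4]
    exact J.sum_mul_sum S c h1 h2 _ _
  have hpi' : J.mul p p = p := hpi
  have hq : J.IsIdempotent (J.e - p) := by
    unfold IsIdempotent
    simp [J.unit, J.mul_e, hpi']
  have hsum : ∑ t ∈ S, (t * t) * ⟪J.e - p, c t⟫ = 0 := by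
    have : ⟪J.e - p, J.mul x x⟫ = 0 := by
      rw [← J.compat, J.comm x (J.e - p)]
      simp [J.unit, hx]
    rw [hb, inner_sum] at this
    simpa [inner_smul_right] using this
  rw [Finset.sum_eq_zero_iff_of_nonneg (fun t ht => mul_nonneg (mul_self_nonneg t)
    (J.inner_cone (J.idem_mem hq) (J.idem_mem (h1 t ht))))] at hsum
  have hc : ∀ t ∈ S, t ≠ 0 → J.mul p (c t) = c t := by
    intro t ht ht0
    have h := (mul_eq_zero.mp (hsum t ht)).resolve_left (mul_ne_zero ht0 ht0)
    have h' : J.mul (J.e - p) (c t) = 0 := by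
      apply J.idem_inner_zero hq
      have hct : J.mul (c t) (c t) = c t := h1 t ht
      rw [J.comm, J.compat, hct, h]
    rw [map_sub, LinearMap.sub_apply, J.unit, sub_eq_zero] at h'
    exact h'.symm
  by_cases hall : ∀ t ∈ S, t • c t = 0
  · exact ⟨0, by rw [← h4, Finset.sum_eq_zero hall, zero_smul]⟩
  push Not at hall
  obtain ⟨s, hs, hsc⟩ := hall
  have hs0 : s ≠ 0 := fun h => hsc (by rw [h, zero_smul])
  have hc0 : c s ≠ 0 := fun h => hsc (by rw [h, smul_zero])
  have hcs : J.mul (c s) (c s) = c s := h1 s hs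
  have hps : J.mul p (c s) = c s := hc s hs hs0
  have hcp : p - c s = 0 := by
    by_contra hne
    refine hpp ⟨c s, p - c s, h1 s hs, ?_, hc0, hne, ?_, by abel⟩
    · unfold IsIdempotent
      simp [hpi', hcs, hps, J.comm (c s) p]
    · simp [hcs, hps, J.comm (c s) p]
  rw [sub_eq_zero] at hcp
  refine ⟨s, ?_⟩
  rw [← h4, hcp]
  refine Finset.sum_eq_single s (fun t ht hts => ?_) (fun h => absurd hs h)
  by_cases ht0 : t = 0
  · rw [ht0, zero_smul]
  · rw [← hc t ht ht0, hcp, h2 s hs t ht hts.symm, smul_zero]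

/-- Squares of off-diagonal Peirce elements. -/
lemma peirce_sq (htr : J.TraceNormalized) {p q z : V} (hp : J.IsPrimitive p)
    (hq : J.IsPrimitive q) (hpq : J.mul p q = 0) (hzp : J.mul p z = (1/2 : ℝ) • z)
    (hzq : J.mul q z = (1/2 : ℝ) • z) :
    J.mul z z = (‖z‖ ^ 2 / 2) • (p + q) := by
  have hp1 : J.mul p p = p := hp.1
  have hq1 : J.mul q q = q := hq.1
  have hqp : J.mul q p = 0 := by rw [J.comm, hpq]
  have hcc : J.mul (p + q) (p + q) = p + q := by simp [hp1, hq1, hpq, hqp]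
  have hcz : J.mul (p + q) z = z := by
    rw [map_add, LinearMap.add_apply, hzp, hzq, ← add_smul]; norm_num
  have hw : J.mul (p + q) (J.mul z z) = J.mul z z := by
    have h := J.lin (p + q) z z
    simp only [hcc, hcz] at h
    linear_combination (norm := module) - h
  have h1 : ∀ a : V, J.mul a a = a → J.mul a z = (1/2 : ℝ) • z →
      J.mul a (J.mul a (J.mul z z)) = J.mul a (J.mul z z) := by
    intro a ha haz
    have h := J.lin' z a a
    have hza : J.mul z a = (1/2 : ℝ) • z := by rw [J.comm, haz]
    simp only [hza, ha, haz, map_smul, LinearMap.smul_apply] at h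
    rw [J.comm (J.mul z z) a, J.comm _ a] at h
    rw [h]
    module
  obtain ⟨s, hs⟩ := J.prim_line hp (h1 p hp1 hzp)
  obtain ⟨t, ht⟩ := J.prim_line hq (h1 q hq1 hzq)
  have hw2 : J.mul z z = s • p + t • q := by
    rw [← hs, ← ht, ← LinearMap.add_apply, ← map_add, hw]
  have hpp := htr p hp
  have hqq := htr q hq
  have hipq : ⟪p, q⟫ = 0 := by
    have := J.compat p p q
    rw [hpq, hp1, inner_zero_right] at this
    exact this
  have hiqp : ⟪q, p⟫ = 0 := by rw [real_inner_comm, hipq]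
  have hsv : s = ‖z‖ ^ 2 / 2 := by
    have h : ⟪J.mul z z, p⟫ = ‖z‖ ^ 2 / 2 := by
      rw [J.compat, J.comm, hzp, inner_smul_right, real_inner_self_eq_norm_sq]; ring
    rw [hw2, inner_add_left, inner_smul_left, inner_smul_left, hpp, hiqp] at h
    simpa using h
  have htv : t = ‖z‖ ^ 2 / 2 := by
    have h : ⟪J.mul z z, q⟫ = ‖z‖ ^ 2 / 2 := by
      rw [J.compat, J.comm, hzq, inner_smul_right, real_inner_self_eq_norm_sq]; ring
    rw [hw2, inner_add_left, inner_smul_left, inner_smul_left, hqq, hipq] at h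
    simpa using h
  rw [hw2, hsv, htv, smul_add]

lemma combo_mem {p q z : V} (hp : J.mul p p = p) (hq : J.mul q q = q) (hpq : J.mul p q = 0)
    (hzp : J.mul p z = (1/2 : ℝ) • z) (hzq : J.mul q z = (1/2 : ℝ) • z)
    (hz : J.mul z z = p + q) (s t : ℝ) (hst : 0 < s ^ 2 + t ^ 2) :
    (s ^ 2) • p + (t ^ 2) • q + (s * t) • z ∈ J.cone := by
  apply J.mem_of_sq hst
  have hqp : J.mul q p = 0 := by rw [J.comm, hpq]
  have hpz : J.mul z p = (1/2 : ℝ) • z := by rw [J.comm, hzp]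
  have hqz : J.mul z q = (1/2 : ℝ) • z := by rw [J.comm, hzq]
  simp only [map_add, map_smul, LinearMap.add_apply, LinearMap.smul_apply, hp, hq, hpq, hqp, hzp,
    hzq, hpz, hqz, hz]
  module

lemma norm_le_cone : ∃ C : ℝ, 0 ≤ C ∧ ∀ ξ ∈ J.cone, ‖ξ‖ ≤ C * ⟪ξ, J.e⟫ := by
  let B : V →L[ℝ] V →L[ℝ] V :=
    LinearMap.toContinuousLinearMap ((LinearMap.toContinuousLinearMap (𝕜 := ℝ) (E := V) (F' := V)).toLinearMap ∘ₗ J.mul)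
  refine ⟨‖B‖, B.opNorm_nonneg, ?_⟩
  rintro ξ ⟨x, rfl⟩
  have h1 : ⟪J.mul x x, J.e⟫ = ‖x‖ * ‖x‖ := by
    rw [J.compat, mul_e, real_inner_self_eq_norm_mul_norm]
  rw [h1, ← mul_assoc]
  exact B.le_opNorm₂ x x

end Helpers

end EuclideanJordanAlgebra

section MeasureHelpers

variable {V : Type*} [NormedAddCommGroup V] [InnerProductSpace ℝ V]
  [FiniteDimensional ℝ V] [MeasurableSpace V] [BorelSpace V]

open EuclideanJordanAlgebra

/-- From the jump hypothesis: integrability of the linear functional near zero. -/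
lemma ejHelper_fin {χ : V → V} {μ : Measure V} {u : V} {ε : ℝ}
    (hε : ∀ ξ ∈ Metric.ball (0 : V) ε, χ ξ = ξ)
    (h : Integrable (fun ξ => ⟪χ ξ, u⟫) μ) :
    (∫⁻ ξ in Metric.ball (0 : V) ε, ENNReal.ofReal ⟪ξ, u⟫ ∂μ) < ⊤ := by
  refine lt_of_le_of_lt ?_ h.hasFiniteIntegral
  refine le_trans (setLIntegral_mono' (g := fun ξ => ‖⟪χ ξ, u⟫‖ₑ) measurableSet_ball ?_)
    (setLIntegral_le_lintegral _ _)
  intro ξ hξ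
  rw [hε ξ hξ]
  exact Real.ofReal_le_enorm _

lemma ejHelper_step {J : EuclideanJordanAlgebra V} {M : V → Measure V} {ε : ℝ}
    (htr : J.TraceNormalized)
    (M_add : ∀ x ∈ J.cone, ∀ y ∈ J.cone, M (x + y) = M x + M y)
    (M_supp : ∀ x ∈ J.cone, M x J.coneᶜ = 0)
    (hfin : ∀ u ∈ J.cone, ∀ x ∈ J.cone, ⟪u, x⟫ = 0 →
      (∫⁻ ξ in Metric.ball (0 : V) ε, ENNReal.ofReal ⟪ξ, u⟫ ∂(M x)) < ⊤)
    {p q z : V} (hp : J.IsPrimitive p) (hq : J.IsPrimitive q) (hpq : J.mul p q = 0)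
    (hzp : J.mul p z = (1/2 : ℝ) • z) (hzq : J.mul q z = (1/2 : ℝ) • z) (hz0 : z ≠ 0) :
    (∫⁻ ξ in Metric.ball (0 : V) ε, ENNReal.ofReal ⟪ξ, p⟫ ∂(M p)) < ⊤ := by
  -- normalize `z`
  obtain ⟨z, hzp, hzq, hz⟩ : ∃ z : V, J.mul p z = (1/2 : ℝ) • z ∧ J.mul q z = (1/2 : ℝ) • z ∧
      J.mul z z = p + q := by
    have hk : 0 < ‖z‖ ^ 2 / 2 := by positivity
    refine ⟨(√(‖z‖ ^ 2 / 2))⁻¹ • z, ?_, ?_, ?_⟩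
    · rw [map_smul, hzp, smul_comm]
    · rw [map_smul, hzq, smul_comm]
    · rw [map_smul, map_smul, LinearMap.smul_apply, J.peirce_sq htr hp hq hpq hzp hzq, smul_smul,
        smul_smul, ← mul_inv, Real.mul_self_sqrt hk.le, inv_mul_cancel₀ hk.ne', one_smul]
  have hp1 : J.mul p p = p := hp.1
  have hq1 : J.mul q q = q := hq.1
  have hmem := J.combo_mem hp1 hq1 hpq hzp hzq hz
  have hiqp : ⟪q, p⟫ = 0 := by
    rw [← hp1, ← J.compat, hpq, inner_zero_left]
  have hpK : p ∈ J.cone := J.idem_mem hp.1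
  have hqK : q ∈ J.cone := J.idem_mem hq.1
  set a : V := (1/2 : ℝ) • (p + q + z) with ha
  set b : V := (1/2 : ℝ) • (p + q - z) with hb
  have haK : a ∈ J.cone := by
    have := hmem (√(1/2)) (√(1/2)) (by positivity)
    rw [Real.sq_sqrt (by norm_num), Real.mul_self_sqrt (by norm_num)] at this
    rwa [ha, smul_add, smul_add]
  have hbK : b ∈ J.cone := by
    have := hmem (√(1/2)) (-√(1/2)) (by positivity)
    rw [neg_sq, mul_neg, Real.sq_sqrt (by norm_num), Real.mul_self_sqrt (by norm_num)] at this
    rwa [hb, smul_sub, smul_add, sub_eq_add_neg, ← neg_smul]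
  have hzz : ⟪z, z⟫ = ⟪p + q, p + q⟫ := by
    have h1 : ⟪z, z⟫ = ⟪p + q, J.e⟫ := by rw [← hz, J.compat, J.mul_e]
    have h2 : J.mul (p + q) (p + q) = p + q := by
      simp [hp1, hq1, hpq, J.comm q p]
    have h3 : ⟪p + q, p + q⟫ = ⟪p + q, J.e⟫ := by
      conv_rhs => rw [← h2, J.compat, J.mul_e]
    rw [h1, h3]
  have hab : ⟪a, b⟫ = 0 := by
    rw [ha, hb, inner_smul_left, inner_smul_right, inner_sub_right, inner_add_left (p + q) z,
      inner_add_left (p + q) z, hzz, real_inner_comm z (p + q)]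
    ring
  have hba : ⟪b, a⟫ = 0 := by rw [real_inner_comm, hab]
  have hsum : a + b = p + q := by rw [ha, hb]; module
  have hM : M p + M q = M a + M b := by
    rw [← M_add p hpK q hqK, ← M_add a haK b hbK, hsum]
  set U := Metric.ball (0 : V) ε
  set f : V → ℝ≥0∞ := fun ξ => ENNReal.ofReal (⟪ξ, p⟫ - 2 * ⟪ξ, q⟫) with hf
  have hbound : ∀ ξ ∈ J.cone, f ξ ≤ 4 * ENNReal.ofReal ⟪ξ, a⟫ ∧
      f ξ ≤ 4 * ENNReal.ofReal ⟪ξ, b⟫ := by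
    intro ξ hξ
    have h1 := J.inner_cone hξ (hmem 1 2 (by norm_num))
    have h2 := J.inner_cone hξ (hmem 1 (-2) (by norm_num))
    have h4 : (4 : ℝ≥0∞) = ENNReal.ofReal 4 := by norm_num
    rw [h4, ← ENNReal.ofReal_mul (by norm_num), ← ENNReal.ofReal_mul (by norm_num)]
    simp only [inner_add_right, inner_smul_right] at h1 h2
    constructor <;> refine ENNReal.ofReal_le_ofReal ?_
    · simp only [ha, inner_add_right, inner_smul_right]; linarith
    · simp only [hb, inner_add_right, inner_sub_right, inner_smul_right]; linarith
  have hae : ∀ x ∈ J.cone, ∀ᵐ ξ ∂((M x).restrict U), ξ ∈ J.cone := fun x hx =>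
    ae_restrict_of_ae (by rw [ae_iff]; exact M_supp x hx)
  have hI : ∀ x ∈ J.cone, ∀ u ∈ J.cone, ⟪u, x⟫ = 0 →
      (∀ ξ ∈ J.cone, f ξ ≤ 4 * ENNReal.ofReal ⟪ξ, u⟫) → (∫⁻ ξ in U, f ξ ∂(M x)) < ⊤ := by
    intro x hx u hu hux hfu
    calc (∫⁻ ξ in U, f ξ ∂(M x)) ≤ ∫⁻ ξ in U, 4 * ENNReal.ofReal ⟪ξ, u⟫ ∂(M x) :=
          lintegral_mono_ae ((hae x hx).mono hfu)
      _ = 4 * ∫⁻ ξ in U, ENNReal.ofReal ⟪ξ, u⟫ ∂(M x) :=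
          lintegral_const_mul' _ _ (by norm_num)
      _ < ⊤ := ENNReal.mul_lt_top (by norm_num) (hfin u hu x hx hux)
  have hfp : (∫⁻ ξ in U, f ξ ∂(M p)) < ⊤ := by
    calc (∫⁻ ξ in U, f ξ ∂(M p)) ≤ ∫⁻ ξ in U, f ξ ∂(M p + M q) := by
          rw [Measure.restrict_add, lintegral_add_measure]; exact le_self_add
      _ = (∫⁻ ξ in U, f ξ ∂(M a)) + ∫⁻ ξ in U, f ξ ∂(M b) := by
          rw [hM, Measure.restrict_add, lintegral_add_measure]
      _ < ⊤ := ENNReal.add_lt_top.mpr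
          ⟨hI a haK b hbK hba fun ξ hξ => (hbound ξ hξ).2,
            hI b hbK a haK hab fun ξ hξ => (hbound ξ hξ).1⟩
  calc (∫⁻ ξ in U, ENNReal.ofReal ⟪ξ, p⟫ ∂(M p))
      ≤ ∫⁻ ξ in U, (f ξ + 2 * ENNReal.ofReal ⟪ξ, q⟫) ∂(M p) := by
        refine lintegral_mono fun ξ => ?_
        have h2 : (2 : ℝ≥0∞) = ENNReal.ofReal 2 := by norm_num
        rw [h2, ← ENNReal.ofReal_mul (by norm_num)]
        refine le_trans (ENNReal.ofReal_le_ofReal ?_) ENNReal.ofReal_add_le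
        linarith
    _ = (∫⁻ ξ in U, f ξ ∂(M p)) + 2 * ∫⁻ ξ in U, ENNReal.ofReal ⟪ξ, q⟫ ∂(M p) := by
        rw [lintegral_add_left (by fun_prop), lintegral_const_mul' _ _ (by norm_num)]
    _ < ⊤ := ENNReal.add_lt_top.mpr ⟨hfp, ENNReal.mul_lt_top (by norm_num)
        (hfin q hqK p hpK hiqp)⟩

lemma ejHelper_final {J : EuclideanJordanAlgebra V} {μ : Measure V} {ε : ℝ} (hε : 0 < ε)
    (hsupp : μ J.coneᶜ = 0)
    (hint : (∫⁻ ξ, ENNReal.ofReal (min (‖ξ‖ ^ 2) 1) ∂μ) < ⊤)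
    (he : (∫⁻ ξ in Metric.ball (0 : V) ε, ENNReal.ofReal ⟪ξ, J.e⟫ ∂μ) < ⊤) :
    (∫⁻ ξ, ENNReal.ofReal (min ‖ξ‖ 1) ∂μ) < ⊤ := by
  obtain ⟨C, hC0, hC⟩ := J.norm_le_cone
  have hm : 0 < min (ε ^ 2) 1 := by positivity
  have hae : ∀ᵐ ξ ∂μ, ξ ∈ J.cone := by rw [ae_iff]; exact hsupp
  rw [← lintegral_add_compl _ (measurableSet_ball (x := (0 : V)) (ε := ε))]
  refine ENNReal.add_lt_top.mpr ⟨?_, ?_⟩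
  · calc _ ≤ ∫⁻ ξ in Metric.ball (0 : V) ε, ENNReal.ofReal C * ENNReal.ofReal ⟪ξ, J.e⟫ ∂μ := by
          refine lintegral_mono_ae ((ae_restrict_of_ae hae).mono fun ξ hξ => ?_)
          rw [← ENNReal.ofReal_mul hC0]
          exact ENNReal.ofReal_le_ofReal ((min_le_left _ _).trans (hC ξ hξ))
      _ = ENNReal.ofReal C * ∫⁻ ξ in Metric.ball (0 : V) ε, ENNReal.ofReal ⟪ξ, J.e⟫ ∂μ :=
          lintegral_const_mul' _ _ ENNReal.ofReal_ne_top
      _ < ⊤ := ENNReal.mul_lt_top ENNReal.ofReal_lt_top he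
  · calc _ ≤ ∫⁻ ξ in (Metric.ball (0 : V) ε)ᶜ,
            ENNReal.ofReal (min (ε ^ 2) 1)⁻¹ * ENNReal.ofReal (min (‖ξ‖ ^ 2) 1) ∂μ := by
          refine setLIntegral_mono' measurableSet_ball.compl fun ξ hξ => ?_
          rw [← ENNReal.ofReal_mul (by positivity)]
          refine ENNReal.ofReal_le_ofReal ((min_le_right _ _).trans ?_)
          have h1 : ε ≤ ‖ξ‖ := by simpa using hξ
          rw [inv_mul_eq_div, le_div_iff₀ hm, one_mul]
          exact min_le_min_right _ (by gcongr)
      _ ≤ ∫⁻ ξ, ENNReal.ofReal (min (ε ^ 2) 1)⁻¹ * ENNReal.ofReal (min (‖ξ‖ ^ 2) 1) ∂μ :=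
          setLIntegral_le_lintegral _ _
      _ = ENNReal.ofReal (min (ε ^ 2) 1)⁻¹ * ∫⁻ ξ, ENNReal.ofReal (min (‖ξ‖ ^ 2) 1) ∂μ :=
          lintegral_const_mul' _ _ ENNReal.ofReal_ne_top
      _ < ⊤ := ENNReal.mul_lt_top ENNReal.ofReal_lt_top hint

end MeasureHelpers

/-- In a simple Euclidean Jordan algebra with trace-normalized inner
product, rank `r > 1` and Peirce invariant `d > 0`, a linear jump kernel `M` on the
cone of squares `K` which integrates `min(‖ξ‖², 1)` and integrates `⟪χ(ξ), u⟫`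
for all orthogonal `u, x ∈ K` must integrate `min(‖ξ‖, 1)`. -/
theorem linear_jumps_finite_variation
    {V : Type*} [NormedAddCommGroup V] [InnerProductSpace ℝ V] [FiniteDimensional ℝ V]
    [MeasurableSpace V] [BorelSpace V]
    (J : EuclideanJordanAlgebra V) (hsimple : J.IsSimple)
    (htr : J.TraceNormalized)
    (r d : ℕ) (hr : 1 < r) (hd : 0 < d)
    (hrank : J.HasRank r) (hpeirce : J.HasPeirceInvariant d)
    (χ : V → V) (hχ : IsTruncation χ)
    (M : V → Measure V)
    (M_sigma : ∀ x ∈ J.cone, SigmaFinite (M x))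
    (M_add : ∀ x ∈ J.cone, ∀ y ∈ J.cone, M (x + y) = M x + M y)
    (M_smul : ∀ (c : ℝ), 0 ≤ c → ∀ x ∈ J.cone, M (c • x) = ENNReal.ofReal c • M x)
    (M_supp : ∀ x ∈ J.cone, M x J.coneᶜ = 0)
    (M_zero : ∀ x ∈ J.cone, M x {0} = 0)
    (M_int : ∀ x ∈ J.cone, (∫⁻ ξ, ENNReal.ofReal (min (‖ξ‖ ^ 2) 1) ∂(M x)) < ⊤)
    (hjump : ∀ u ∈ J.cone, ∀ x ∈ J.cone, ⟪u, x⟫ = 0 →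
      Integrable (fun ξ => ⟪χ ξ, u⟫) (M x)) :
    ∀ x ∈ J.cone, (∫⁻ ξ, ENNReal.ofReal (min ‖ξ‖ 1) ∂(M x)) < ⊤ := by
  obtain ⟨-, -, hχ0⟩ := hχ
  obtain ⟨ε, hε, hball⟩ := Metric.eventually_nhds_iff_ball.mp hχ0
  have hfin : ∀ u ∈ J.cone, ∀ x ∈ J.cone, ⟪u, x⟫ = 0 →
      (∫⁻ ξ in Metric.ball (0 : V) ε, ENNReal.ofReal ⟪ξ, u⟫ ∂(M x)) < ⊤ :=
    fun u hu x hx hux => ejHelper_fin hball (hjump u hu x hx hux)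
  obtain ⟨⟨p, hp⟩, -⟩ := hrank
  have hframe := hp
  obtain ⟨hprim, horth, hpsum⟩ := hp
  have hpK : ∀ i, p i ∈ J.cone := fun i => J.idem_mem (hprim i).1
  have hpi : ∀ i, (∫⁻ ξ, ENNReal.ofReal (min ‖ξ‖ 1) ∂(M (p i))) < ⊤ := by
    intro i
    have hp1 : J.mul (p i) (p i) = p i := (hprim i).1
    refine ejHelper_final hε (M_supp _ (hpK i)) (M_int _ (hpK i)) ?_
    haveI : Nontrivial (Fin r) := Fin.nontrivial_iff_two_le.mpr hr
    obtain ⟨j, hj⟩ := exists_ne i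
    have hdim := hpeirce r p hframe i j hj.symm
    have hne : J.peirceSpace (p i) (p j) ≠ ⊥ := by
      intro h
      rw [h, finrank_bot] at hdim
      omega
    obtain ⟨z, hz, hz0⟩ := Submodule.exists_mem_ne_zero_of_ne_bot hne
    have hz' : J.mul (p i) z = (1/2 : ℝ) • z ∧ J.mul (p j) z = (1/2 : ℝ) • z := by
      rw [EuclideanJordanAlgebra.peirceSpace, Submodule.mem_inf, LinearMap.mem_ker,
        LinearMap.mem_ker] at hz
      exact ⟨sub_eq_zero.mp hz.1, sub_eq_zero.mp hz.2⟩
    have h1 := ejHelper_step htr M_add M_supp hfin (hprim i) (hprim j) (horth i j hj.symm)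
      hz'.1 hz'.2 hz0
    have hq : J.IsIdempotent (J.e - p i) := by
      unfold EuclideanJordanAlgebra.IsIdempotent
      simp [J.unit, J.mul_e, hp1]
    have hqp : ⟪J.e - p i, p i⟫ = 0 := by
      rw [← hp1, ← J.compat]
      simp [J.mul_e, hp1]
    have h2 := hfin _ (J.idem_mem hq) _ (hpK i) hqp
    calc (∫⁻ ξ in Metric.ball (0 : V) ε, ENNReal.ofReal ⟪ξ, J.e⟫ ∂(M (p i)))
        ≤ ∫⁻ ξ in Metric.ball (0 : V) ε,
            (ENNReal.ofReal ⟪ξ, p i⟫ + ENNReal.ofReal ⟪ξ, J.e - p i⟫) ∂(M (p i)) := by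
          refine lintegral_mono fun ξ => le_trans (ENNReal.ofReal_le_ofReal ?_)
            ENNReal.ofReal_add_le
          rw [inner_sub_right]; linarith
      _ = _ := lintegral_add_left (by fun_prop) _
      _ < ⊤ := ENNReal.add_lt_top.mpr ⟨h1, h2⟩
  have h0 : M 0 = 0 := by
    have := M_smul 0 le_rfl (0 : V) ⟨0, by simp⟩
    simpa using this
  have hsum : ∀ s : Finset (Fin r), J.IsIdempotent (∑ i ∈ s, p i) ∧
      (∫⁻ ξ, ENNReal.ofReal (min ‖ξ‖ 1) ∂(M (∑ i ∈ s, p i))) < ⊤ := by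
    classical
    intro s
    induction s using Finset.induction_on with
    | empty => simp [h0, EuclideanJordanAlgebra.IsIdempotent]
    | insert i s his ih =>
      have hp1 : J.mul (p i) (p i) = p i := (hprim i).1
      have ih1 : J.mul (∑ i ∈ s, p i) (∑ i ∈ s, p i) = ∑ i ∈ s, p i := ih.1
      have hz : J.mul (p i) (∑ i ∈ s, p i) = 0 := by
        rw [map_sum]
        exact Finset.sum_eq_zero fun j hj => horth i j (fun h => his (h ▸ hj))
      rw [Finset.sum_insert his]
      refine ⟨?_, ?_⟩
      · unfold EuclideanJordanAlgebra.IsIdempotent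
        rw [map_add, map_add, LinearMap.add_apply, LinearMap.add_apply, hp1, ih1, hz,
          J.comm _ (p i), hz]
        simp
      · rw [M_add _ (hpK i) _ (J.idem_mem ih.1), lintegral_add_measure]
        exact ENNReal.add_lt_top.mpr ⟨hpi i, ih.2⟩
  have hE := hsum Finset.univ
  rw [hpsum] at hE
  intro x hx
  obtain ⟨C, hC0, hC⟩ := J.exists_bound hx
  have hM : M x + M (C • J.e - x) = ENNReal.ofReal C • M J.e := by
    rw [← M_add x hx _ hC, add_sub_cancel, M_smul C hC0 _ (J.idem_mem hE.1)]
  calc (∫⁻ ξ, ENNReal.ofReal (min ‖ξ‖ 1) ∂(M x))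
      ≤ ∫⁻ ξ, ENNReal.ofReal (min ‖ξ‖ 1) ∂(M x + M (C • J.e - x)) := by
        rw [lintegral_add_measure]; exact le_self_add
    _ < ⊤ := by
        rw [hM, lintegral_smul_measure, smul_eq_mul]
        exact ENNReal.mul_lt_top ENNReal.ofReal_lt_top hE.2
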